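/- For n, k ≥ 2 and j ∈ [n-1], let D_{n,k} be the set of words w ∈ ℤ^k with (|w(1)|, w(2), ..., w(k)) ∈ [n-1]^k, and let h_{n,k,j}(x) = Σ x^{des(w)} over all w ∈ D_{n,k} with w(k) = j. Then: (i) h_{n,k+1,j}(x) = Σ_{i=1}^{j-1} h_{n,k,i}(x) + x · Σ_{i=j}^{n-1} h_{n,k,i}(x) for all j ∈ [n-1]; and (ii) the sequence (h_{n,k,n-1}(x), ..., h_{n,k,2}(x), h_{n,k,1}(x)) is an interlacing sequence of real-rooted polynomials. -/

import Mathlib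

open Polynomial

open scoped Classical

noncomputable section

/-- The descent set of a permutation `w` of `Fin n`, recorded as a subset of
`{1, ..., n-1}` (1-based positions, as in the paper: `i ∈ Des(w)` iff `w(i) > w(i+1)`). -/
def descSet {n : ℕ} (w : Equiv.Perm (Fin n)) : Finset ℕ :=
  (Finset.univ.filter (fun i : Fin (n - 1) =>
      w ⟨i.val + 1, by have := i.isLt; omega⟩ < w ⟨i.val, by have := i.isLt; omega⟩)).image
    (fun i => i.val + 1)

/-- `A^T_n(x) = Σ_{w ∈ S_n, Des(w) ⊆ T} x^{des(w)}` (note `Des(w) ⊆ {1,...,n-1}`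
automatically, so this also realizes the convention `A^T_n := A^{T ∩ [n-1]}_n`). -/
def Apoly (n : ℕ) (T : Finset ℕ) : Polynomial ℝ :=
  ∑ w ∈ Finset.univ.filter (fun w : Equiv.Perm (Fin n) => descSet w ⊆ T),
    X ^ (descSet w).card

/-- `p^T_{n,k}(x) = Σ x^{des(w)}` over permutations `w ∈ S_{n+1}` with `w(1) = k+1`
(0-based: `w 0 = k`) and `Des(w) ⊆ T`. -/
def ppoly (n k : ℕ) (T : Finset ℕ) : Polynomial ℝ :=
  ∑ w ∈ Finset.univ.filter (fun w : Equiv.Perm (Fin (n + 1)) =>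
      (w 0 : ℕ) = k ∧ descSet w ⊆ T),
    X ^ (descSet w).card

/-- A real polynomial has only real roots (or is identically zero). -/
def RealRooted (p : Polynomial ℝ) : Prop :=
  p = 0 ∨ ∀ z : ℂ, Polynomial.aeval z p = 0 → z.im = 0

/-- The list of real roots of `p`, with multiplicity, in decreasing order. -/
def rootsDesc (p : Polynomial ℝ) : List ℝ :=
  (p.roots.sort (· ≤ ·)).reverse

/-- `Interlaces p q` means `p ⪯ q`: both are real-rooted and, listing the roots of `p`
as `α_1 ≥ α_2 ≥ ⋯` and those of `q` as `β_1 ≥ β_2 ≥ ⋯`, one has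
`⋯ ≤ α_2 ≤ β_2 ≤ α_1 ≤ β_1`; by convention the zero polynomial interlaces and is
interlaced by every real-rooted polynomial. -/
def Interlaces (p q : Polynomial ℝ) : Prop :=
  (p = 0 ∧ RealRooted q) ∨ (q = 0 ∧ RealRooted p) ∨
  (RealRooted p ∧ RealRooted q ∧
    Multiset.card q.roots ≤ Multiset.card p.roots + 1 ∧
    Multiset.card p.roots ≤ Multiset.card q.roots ∧
    (∀ (i : ℕ) (hp : i < (rootsDesc p).length) (hq : i < (rootsDesc q).length),
      (rootsDesc p).get ⟨i, hp⟩ ≤ (rootsDesc q).get ⟨i, hq⟩) ∧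
    (∀ (i : ℕ) (hq : i + 1 < (rootsDesc q).length) (hp : i < (rootsDesc p).length),
      (rootsDesc q).get ⟨i + 1, hq⟩ ≤ (rootsDesc p).get ⟨i, hp⟩))

/-- The descent set of a word `w ∈ [r]^n` (encoded as `w : Fin n → Fin r`), as a subset
of `{1,…,n-1}` (1-based): `i` is a descent iff `w(i) ≥ w(i+1)`. -/
def descSetW {n r : ℕ} (w : Fin n → Fin r) : Finset ℕ :=
  (Finset.univ.filter (fun i : Fin (n - 1) =>
      w ⟨i.val + 1, by have := i.isLt; omega⟩ ≤ w ⟨i.val, by have := i.isLt; omega⟩)).image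
    (fun i => i.val + 1)

/-- `E_{n,r}(x) = Σ_{w ∈ [r]^n} x^{des(w)}`. -/
def Epoly (n r : ℕ) : Polynomial ℝ :=
  ∑ w : Fin n → Fin r, X ^ (descSetW w).card

/-- The set `D_{n,k}` of words `w ∈ ℤ^k` such that `(|w(1)|, w(2), …, w(k)) ∈ [n-1]^k`. -/
def Dword (n k : ℕ) : Finset (Fin k → ℤ) :=
  (Fintype.piFinset (fun _ : Fin k => Finset.Icc (-(n : ℤ)) (n : ℤ))).filter
    (fun w => ∀ i : Fin k,
      (i.val = 0 → 1 ≤ |w i| ∧ |w i| ≤ (n : ℤ) - 1) ∧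
      (i.val ≠ 0 → 1 ≤ w i ∧ w i ≤ (n : ℤ) - 1))

/-- The descent set of a word `w ∈ D_{n,k} ⊆ ℤ^k`, as a subset of `{1,…,k-1}`
(1-based): `i` is a descent iff `|w(i)| > w(i+1)`, or `w(i) = w(i+1) > 0`. -/
def descSetD {k : ℕ} (w : Fin k → ℤ) : Finset ℕ :=
  (Finset.univ.filter (fun i : Fin (k - 1) =>
      w ⟨i.val + 1, by have := i.isLt; omega⟩ < |w ⟨i.val, by have := i.isLt; omega⟩| ∨
        (w ⟨i.val, by have := i.isLt; omega⟩ = w ⟨i.val + 1, by have := i.isLt; omega⟩ ∧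
          0 < w ⟨i.val + 1, by have := i.isLt; omega⟩))).image (fun i => i.val + 1)

/-- `h_{n,k,j}(x) = Σ x^{des(w)}` over all words `w ∈ D_{n,k}` with last letter
`w(k) = j`. -/
def hDk (n k j : ℕ) : Polynomial ℝ :=
  ∑ w ∈ (Dword n k).filter
      (fun w => ∀ h : 0 < k, w ⟨k - 1, by omega⟩ = (j : ℤ)),
    X ^ (descSetD w).card


/-- invariant at a point of the upper half plane -/
structure GoodSeq (m : ℕ) (f : ℕ → ℂ) (z : ℂ) : Prop where
  ne : ∀ a, 1 ≤ a → a ≤ m → f a ≠ 0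
  lt : ∀ a b, 1 ≤ a → a < b → b ≤ m → 0 < (f a * (starRingEnd ℂ) (f b)).im
  mul : ∀ a b, 1 ≤ a → a < b → b ≤ m → 0 ≤ (z * f b * (starRingEnd ℂ) (f a)).im

lemma GoodSeq.sum_ne {m : ℕ} {f : ℕ → ℂ} {z : ℂ} (h : GoodSeq m f z) (S : Finset ℕ)
    (hS : S.Nonempty) (hm : ∀ a ∈ S, 1 ≤ a ∧ a ≤ m) : ∑ a ∈ S, f a ≠ 0 := by
  have hM := S.max'_mem hS
  set M := S.max' hS with hMdef
  rw [← Finset.add_sum_erase _ _ hM]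
  rcases (S.erase M).eq_empty_or_nonempty with he | he
  · rw [he]; simpa using h.ne M (hm M hM).1 (hm M hM).2
  · intro h0
    have h1 : 0 < ((f M + ∑ a ∈ S.erase M, f a) * (starRingEnd ℂ) (f M)).im := by
      rw [add_mul, Complex.add_im, Complex.mul_conj, Complex.ofReal_im, zero_add,
        Finset.sum_mul, Complex.im_sum]
      apply Finset.sum_pos _ he
      intro a ha
      have ha' := Finset.mem_erase.1 ha
      exact h.lt a M (hm a ha'.2).1 (lt_of_le_of_ne (S.le_max' a ha'.2) ha'.1) (hm M hM).2
    rw [h0] at h1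
    simp at h1

lemma GoodSeq.sum_lt {m : ℕ} {f : ℕ → ℂ} {z : ℂ} (h : GoodSeq m f z) (S T : Finset ℕ)
    (hS : ∀ a ∈ S, 1 ≤ a) (hT : ∀ a ∈ T, a ≤ m) (hST : ∀ a ∈ S, ∀ b ∈ T, a < b) :
    0 ≤ ((∑ a ∈ S, f a) * (starRingEnd ℂ) (∑ a ∈ T, f a)).im := by
  rw [map_sum, Finset.sum_mul_sum, Complex.im_sum]
  refine Finset.sum_nonneg fun a ha => ?_
  rw [Complex.im_sum]
  exact Finset.sum_nonneg fun b hb => (h.lt a b (hS a ha) (hST a ha b hb) (hT b hb)).le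

lemma GoodSeq.sum_mul {m : ℕ} {f : ℕ → ℂ} {z : ℂ} (h : GoodSeq m f z) (S T : Finset ℕ)
    (hS : ∀ a ∈ S, 1 ≤ a) (hT : ∀ a ∈ T, a ≤ m) (hST : ∀ a ∈ S, ∀ b ∈ T, a < b) :
    0 ≤ (z * (∑ a ∈ T, f a) * (starRingEnd ℂ) (∑ a ∈ S, f a)).im := by
  have e : z * (∑ a ∈ T, f a) = ∑ a ∈ T, z * f a := Finset.mul_sum ..
  rw [e, map_sum, Finset.sum_mul_sum, Complex.im_sum]
  refine Finset.sum_nonneg fun b hb => ?_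
  rw [Complex.im_sum]
  exact Finset.sum_nonneg fun a ha => (h.mul a b (hS a ha) (hST a ha b hb) (hT b hb))

lemma GoodSeq.step {m : ℕ} {f g : ℕ → ℂ} {z : ℂ} (hz : 0 < z.im) (h : GoodSeq m f z)
    (hg : ∀ j, 1 ≤ j → j ≤ m →
      g j = (∑ i ∈ Finset.Ico 1 j, f i) + z * ∑ i ∈ Finset.Icc j m, f i) :
    GoodSeq m g z := by
  have key : ∀ a b, 1 ≤ a → a < b → b ≤ m → ∃ A B C : ℂ,
      g a = A + z * (B + C) ∧ g b = (A + B) + z * C ∧ B ≠ 0 ∧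
      0 ≤ (A * (starRingEnd ℂ) B).im ∧
      0 ≤ (B * (starRingEnd ℂ) C).im ∧
      0 ≤ (z * B * (starRingEnd ℂ) A).im ∧
      0 ≤ (z * C * (starRingEnd ℂ) B).im := by
    intro a b h1 hab hbm
    refine ⟨∑ i ∈ Finset.Ico 1 a, f i, ∑ i ∈ Finset.Ico a b, f i, ∑ i ∈ Finset.Icc b m, f i,
      ?_, ?_, ?_, ?_, ?_, ?_, ?_⟩
    · rw [hg a h1 (by omega)]
      congr 2
      rw [← Finset.sum_union]
      · apply Finset.sum_congr _ (fun _ _ => rfl)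
        ext x; simp; omega
      · rw [Finset.disjoint_left]; intro x; simp; omega
    · rw [hg b (by omega) hbm, Finset.sum_Ico_consecutive _ h1 hab.le]
    · apply h.sum_ne
      · simpa using hab
      · intro x; simp; omega
    · apply h.sum_lt <;> simp <;> omega
    · apply h.sum_lt <;> simp <;> omega
    · apply h.sum_mul <;> simp <;> omega
    · apply h.sum_mul <;> simp <;> omega
  refine ⟨?_, ?_, ?_⟩
  · intro a h1 ha h0
    rw [hg a h1 ha] at h0
    have hA := h.sum_lt (Finset.Ico 1 a) (Finset.Icc a m) (by simp; omega) (by simp)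
      (by simp; omega)
    have hC := h.sum_ne (Finset.Icc a m) (by simpa using ha) (by simp; omega)
    rw [eq_neg_of_add_eq_zero_left h0] at hA
    rw [neg_mul, mul_assoc, Complex.mul_conj, Complex.neg_im, Complex.im_mul_ofReal] at hA
    have := Complex.normSq_pos.2 hC
    nlinarith [mul_pos hz this]
  · intro a b h1 hab hb
    obtain ⟨A, B, C, ha, hb, hB, e1, e2, e3, e4⟩ := key a b h1 hab hb
    have id1 : (g a * (starRingEnd ℂ) (g b)).im = (A * (starRingEnd ℂ) B).im +
        (z * B * (starRingEnd ℂ) A).im + z.im * Complex.normSq B +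
        Complex.normSq z * (B * (starRingEnd ℂ) C).im + (z * C * (starRingEnd ℂ) B).im := by
      rw [ha, hb]
      simp [Complex.normSq_apply]
      ring
    have := mul_pos hz (Complex.normSq_pos.2 hB)
    have := mul_nonneg (Complex.normSq_nonneg z) e2
    linarith
  · intro a b h1 hab hb
    obtain ⟨A, B, C, ha, hb, hB, e1, e2, e3, e4⟩ := key a b h1 hab hb
    have id1 : (z * g b * (starRingEnd ℂ) (g a)).im =
        z.im * Complex.normSq (A + z * C) + Complex.normSq z * (A * (starRingEnd ℂ) B).im +
        (z * B * (starRingEnd ℂ) A).im + 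
        Complex.normSq z * (B * (starRingEnd ℂ) C).im +
        Complex.normSq z * (z * C * (starRingEnd ℂ) B).im := by
      rw [ha, hb]
      simp [Complex.normSq_apply]
      ring
    have := mul_nonneg hz.le (Complex.normSq_nonneg (A + z * C))
    have := mul_nonneg (Complex.normSq_nonneg z) e1
    have := mul_nonneg (Complex.normSq_nonneg z) e2
    have := mul_nonneg (Complex.normSq_nonneg z) e4
    linarith

open Filter Topology in
lemma tendsto_arg_line (ε β : ℝ) :
    Tendsto (fun s : ℝ => Complex.arg ((s : ℂ) + ε * Complex.I - β)) atTop (𝓝 0) := by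
  have h1 : Tendsto (fun s : ℝ => Complex.arg (1 + ((s⁻¹ : ℝ) : ℂ) * (ε * Complex.I - β))) atTop
      (𝓝 (Complex.arg (1 + ((0 : ℝ) : ℂ) * (ε * Complex.I - β)))) := by
    refine Tendsto.comp (g := Complex.arg) (y := 𝓝 (1 + ((0 : ℝ) : ℂ) * (ε * Complex.I - β))) ?_ ?_
    · apply Complex.continuousAt_arg; simp
    · apply Tendsto.const_add
      apply Tendsto.mul_const
      exact (Complex.continuous_ofReal.tendsto 0).comp tendsto_inv_atTop_zero
  simp only [Complex.ofReal_zero, zero_mul, add_zero, Complex.arg_one] at h1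
  refine h1.congr' ?_
  filter_upwards [eventually_gt_atTop 0] with s hs
  rw [← Complex.arg_real_mul _ hs]
  congr 1
  have : (s : ℂ) ≠ 0 := by exact_mod_cast hs.ne'
  push_cast
  field_simp
  ring

open Filter Topology in
lemma tendsto_arg_vert (t β : ℝ) (h : t ≠ β) :
    Tendsto (fun ε : ℝ => Complex.arg ((t : ℂ) + ε * Complex.I - β)) (𝓝[>] 0)
      (𝓝 (if t < β then Real.pi else 0)) := by
  have hc : Continuous (fun ε : ℝ => ((t : ℂ) + ε * Complex.I - β)) := by fun_prop
  have h0 : Tendsto (fun ε : ℝ => ((t : ℂ) + ε * Complex.I - β)) (𝓝[>] 0)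
      (𝓝 ((t : ℂ) - β)) := by
    have := (hc.tendsto 0).mono_left (nhdsWithin_le_nhds (s := Set.Ioi 0))
    simpa using this
  split_ifs with hlt
  · have := Complex.tendsto_arg_nhdsWithin_im_nonneg_of_re_neg_of_im_zero
      (z := (t : ℂ) - β) (by simpa using hlt) (by simp)
    refine this.comp (tendsto_nhdsWithin_iff.2 ⟨h0, ?_⟩)
    filter_upwards [self_mem_nhdsWithin] with ε hε
    simpa using le_of_lt hε
  · have hlt' : β < t := lt_of_le_of_ne (not_lt.1 hlt) (Ne.symm h)
    have h2 : Complex.arg ((t : ℂ) - β) = 0 := by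
      rw [← Complex.ofReal_sub]; exact Complex.arg_ofReal_of_nonneg (by linarith)
    have h3 : ContinuousAt Complex.arg ((t : ℂ) - β) := by
      apply Complex.continuousAt_arg
      left; simpa using hlt'
    have h4 := Tendsto.comp h3 h0
    rw [h2] at h4
    exact h4

/-- total argument -/
noncomputable def argSum (R : Multiset ℝ) (z : ℂ) : ℝ := (R.map fun β : ℝ => Complex.arg (z - (β : ℂ))).sum

lemma prod_polar (R : Multiset ℝ) (z : ℂ) (hz : 0 < z.im) : ∃ r : ℝ, 0 < r ∧
    (R.map fun β : ℝ => (z - (β : ℂ))).prod = r * Complex.exp (argSum R z * Complex.I) := by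
  induction R using Multiset.induction with
  | empty => exact ⟨1, one_pos, by simp [argSum]⟩
  | cons a R ih =>
    obtain ⟨r, hr, h⟩ := ih
    have hne : z - (a : ℂ) ≠ 0 := by
      intro h0
      have := congrArg Complex.im h0
      simp at this; linarith
    refine ⟨‖z - (a : ℂ)‖ * r, mul_pos (norm_pos_iff.2 hne) hr, ?_⟩
    have := Complex.norm_mul_exp_arg_mul_I (z - (a : ℂ))
    simp only [argSum] at h ⊢
    rw [Multiset.map_cons, Multiset.prod_cons, Multiset.map_cons, Multiset.sum_cons, h]
    push_cast
    rw [add_mul, Complex.exp_add]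
    nth_rewrite 1 [← this]
    ring

open Filter Topology in
lemma argSum_tendsto_line (R : Multiset ℝ) (ε : ℝ) :
    Tendsto (fun s : ℝ => argSum R ((s : ℂ) + ε * Complex.I)) atTop (𝓝 0) := by
  induction R using Multiset.induction with
  | empty => simp [argSum]
  | cons a R ih =>
    have := (tendsto_arg_line ε a).add ih
    simpa [argSum] using this

open Filter Topology in
lemma argSum_tendsto_vert (R : Multiset ℝ) (t : ℝ) (ht : t ∉ R) :
    Tendsto (fun ε : ℝ => argSum R ((t : ℂ) + ε * Complex.I)) (𝓝[>] 0)
      (𝓝 (Real.pi * (R.countP (fun β => t < β) : ℕ))) := by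
  induction R using Multiset.induction with
  | empty => simp [argSum]
  | cons a R ih =>
    simp only [Multiset.mem_cons, not_or] at ht
    have := (tendsto_arg_vert t a ht.1).add (ih ht.2)
    have e : (if t < a then Real.pi else 0) + Real.pi * (R.countP (fun β => t < β) : ℕ)
        = Real.pi * ((a ::ₘ R).countP (fun β => t < β) : ℕ) := by
      rw [Multiset.countP_cons]
      split_ifs <;> push_cast <;> ring
    rw [e] at this
    simpa [argSum] using this

lemma argSum_cont (R : Multiset ℝ) (ε : ℝ) (hε : 0 < ε) :
    Continuous (fun s : ℝ => argSum R ((s : ℂ) + ε * Complex.I)) := by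
  induction R using Multiset.induction with
  | empty => simpa [argSum] using continuous_const
  | cons a R ih =>
    have : Continuous (fun s : ℝ => Complex.arg ((s : ℂ) + ε * Complex.I - a)) := by
      rw [continuous_iff_continuousAt]
      intro s
      have hc : Continuous (fun s : ℝ => ((s : ℂ) + ε * Complex.I - a)) := by fun_prop
      refine ContinuousAt.comp (g := Complex.arg) (Complex.continuousAt_arg ?_) hc.continuousAt
      right; simpa using hε.ne'
    have h2 := this.add ih
    simp only [argSum, Multiset.map_cons, Multiset.sum_cons]
    exact h2

/-- the root count comparison -/
lemma count_of_upper (P Q : Multiset ℝ)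
    (h : ∀ z : ℂ, 0 < z.im → 0 < ((Q.map fun β : ℝ => (z - (β : ℂ))).prod *
      (starRingEnd ℂ) (P.map fun β : ℝ => (z - (β : ℂ))).prod).im)
    (t : ℝ) (htP : t ∉ P) (htQ : t ∉ Q) :
    P.countP (fun β => t < β) ≤ Q.countP (fun β => t < β) ∧
    Q.countP (fun β => t < β) ≤ P.countP (fun β => t < β) + 1 := by
  set F : ℝ → ℝ → ℝ := fun ε s => argSum Q ((s : ℂ) + ε * Complex.I) -
    argSum P ((s : ℂ) + ε * Complex.I) with hF
  have hsin : ∀ ε s, 0 < ε → 0 < Real.sin (F ε s) := by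
    intro ε s hε
    have hz : 0 < ((s : ℂ) + ε * Complex.I).im := by simpa using hε
    have h1 := h _ hz
    obtain ⟨r, hr, e1⟩ := prod_polar Q _ hz
    obtain ⟨r', hr', e2⟩ := prod_polar P _ hz
    rw [e1, e2, map_mul, Complex.conj_ofReal, ← Complex.exp_conj, map_mul, Complex.conj_ofReal,
      Complex.conj_I] at h1
    have e3 : (r : ℂ) * Complex.exp (argSum Q ((s : ℂ) + ε * Complex.I) * Complex.I) *
        (r' * Complex.exp (argSum P ((s : ℂ) + ε * Complex.I) * -Complex.I)) =
        ((r * r' : ℝ) : ℂ) * Complex.exp ((F ε s : ℝ) * Complex.I) := by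
      rw [hF]
      push_cast
      rw [sub_mul, sub_eq_add_neg, Complex.exp_add, mul_neg]
      ring
    rw [e3, Complex.im_ofReal_mul, Complex.exp_ofReal_mul_I_im] at h1
    exact pos_of_mul_pos_right h1 (mul_pos hr hr').le
  have hrange : ∀ ε s, 0 < ε → 0 < F ε s ∧ F ε s < Real.pi := by
    intro ε s hε
    have hcont : Continuous (F ε) := (argSum_cont Q ε hε).sub (argSum_cont P ε hε)
    have hlim : Filter.Tendsto (F ε) Filter.atTop (nhds 0) := by
      simpa using (argSum_tendsto_line Q ε).sub (argSum_tendsto_line P ε)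
    have hev : ∀ᶠ s' in Filter.atTop, F ε s' ∈ Set.Ioo (-Real.pi) Real.pi :=
      hlim.eventually (Ioo_mem_nhds (by linarith [Real.pi_pos]) Real.pi_pos)
    obtain ⟨s', hs'⟩ := hev.exists
    have hs'0 : 0 < F ε s' := by
      by_contra hneg
      have := Real.sin_nonpos_of_nonpos_of_neg_pi_le (not_lt.1 hneg) hs'.1.le
      linarith [hsin ε s' hε]
    constructor
    · by_contra hneg
      obtain ⟨u, hu⟩ := mem_range_of_exists_le_of_exists_ge hcont
        ⟨s, not_lt.1 hneg⟩ ⟨s', hs'0.le⟩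
      have := hsin ε u hε
      rw [hu] at this; simp at this
    · by_contra hneg
      obtain ⟨u, hu⟩ := mem_range_of_exists_le_of_exists_ge hcont
        ⟨s', hs'.2.le⟩ ⟨s, not_lt.1 hneg⟩
      have := hsin ε u hε
      rw [hu] at this; simp at this
  have hlim : Filter.Tendsto (fun ε => F ε t) (nhdsWithin 0 (Set.Ioi 0))
      (nhds (Real.pi * (Q.countP (fun β => t < β) : ℕ) -
        Real.pi * (P.countP (fun β => t < β) : ℕ))) :=
    (argSum_tendsto_vert Q t htQ).sub (argSum_tendsto_vert P t htP)
  have hge := ge_of_tendsto hlim (b := 0) (by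
    filter_upwards [self_mem_nhdsWithin] with ε hε using (hrange ε t hε).1.le)
  have hle := le_of_tendsto hlim (b := Real.pi) (by
    filter_upwards [self_mem_nhdsWithin] with ε hε using (hrange ε t hε).2.le)
  have hpi := Real.pi_pos
  constructor
  · have : ((P.countP (fun β => t < β) : ℕ) : ℝ) ≤ (Q.countP (fun β => t < β) : ℕ) := by
      by_contra hneg
      nlinarith
    exact_mod_cast this
  · have : ((Q.countP (fun β => t < β) : ℕ) : ℝ) ≤ (P.countP (fun β => t < β) : ℕ) + 1 := by
      by_contra hneg
      nlinarith
    exact_mod_cast this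

lemma lt_get_iff_countP (l : List ℝ) (hl : l.Pairwise (· ≥ ·)) (t : ℝ) :
    ∀ (i : ℕ) (hi : i < l.length), t < l.get ⟨i, hi⟩ ↔ i < l.countP (fun β => t < β) := by
  induction l with
  | nil => intro i hi; simp at hi
  | cons a l ih =>
    rw [List.pairwise_cons] at hl
    intro i hi
    rw [List.countP_cons]
    by_cases hta : t < a
    · cases i with
      | zero => simp [hta]
      | succ i =>
        have := ih hl.2 i (by simpa using hi)
        simp only [List.get_cons_succ]
        rw [this]
        simp [hta]
    · have h0 : l.countP (fun β => t < β) = 0 := by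
        rw [List.countP_eq_zero]
        intro b hb
        have := hl.1 b hb
        simp only [decide_eq_true_eq, not_lt]
        linarith [not_lt.1 hta]
      simp only [h0, hta, decide_false, zero_add]
      simp only [Bool.false_eq_true, if_false, not_lt_zero, iff_false, not_lt]
      cases i with
      | zero => simpa using hta
      | succ i =>
        have := hl.1 (l.get ⟨i, by simpa using hi⟩) (List.get_mem _ _)
        simp only [List.get_cons_succ]
        linarith [not_lt.1 hta]

lemma rootsDesc_pairwise (p : Polynomial ℝ) : (rootsDesc p).Pairwise (· ≥ ·) := by
  unfold rootsDesc
  rw [List.pairwise_reverse]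
  exact Multiset.pairwise_sort _ _

lemma rootsDesc_countP (p : Polynomial ℝ) (t : ℝ) :
    (rootsDesc p).countP (fun β => t < β) = p.roots.countP (fun β => t < β) := by
  have h : p.roots = ((rootsDesc p : List ℝ) : Multiset ℝ) := by
    unfold rootsDesc
    rw [Multiset.coe_reverse, Multiset.sort_eq]
  conv_rhs => rw [h]
  rw [Multiset.coe_countP]

lemma rootsDesc_get (p : Polynomial ℝ) (t : ℝ) (i : ℕ) (hi : i < (rootsDesc p).length) :
    t < (rootsDesc p).get ⟨i, hi⟩ ↔ i < p.roots.countP (fun β => t < β) := by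
  rw [lt_get_iff_countP _ (rootsDesc_pairwise p), rootsDesc_countP]

lemma exists_generic (P Q : Multiset ℝ) (a b : ℝ) (h : a < b) :
    ∃ t, a < t ∧ t < b ∧ t ∉ P ∧ t ∉ Q := by
  have := (Set.Ioo_infinite h).sdiff (Finset.finite_toSet (P.toFinset ∪ Q.toFinset))
  obtain ⟨t, ht⟩ := this.nonempty
  simp at ht
  exact ⟨t, ht.1.1, ht.1.2, ht.2.1, ht.2.2⟩

lemma exists_below (P : Multiset ℝ) : ∃ c : ℝ, ∀ t ∈ P, c < t := by
  induction P using Multiset.induction with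
  | empty => exact ⟨0, by simp⟩
  | cons a P ih =>
    obtain ⟨c, hc⟩ := ih
    refine ⟨min c (a - 1), ?_⟩
    intro t ht
    rw [Multiset.mem_cons] at ht
    rcases ht with rfl | ht
    · exact lt_of_le_of_lt (min_le_right _ _) (by linarith)
    · exact lt_of_le_of_lt (min_le_left _ _) (hc t ht)

lemma realRooted_of_upper (p : Polynomial ℝ) (h : ∀ z : ℂ, 0 < z.im → aeval z p ≠ 0) :
    RealRooted p := by
  right
  intro z hz
  rcases lt_trichotomy z.im 0 with h1 | h1 | h1
  · exfalso
    refine h ((starRingEnd ℂ) z) (by simpa using h1) ?_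
    rw [Polynomial.aeval_conj, hz, map_zero]
  · exact h1
  · exact absurd hz (h z h1)

lemma aeval_eq_of_upper (p : Polynomial ℝ) (h : ∀ z : ℂ, 0 < z.im → aeval z p ≠ 0) (z : ℂ) :
    aeval z p = (p.leadingCoeff : ℂ) * (p.roots.map fun β : ℝ => (z - (β : ℂ))).prod := by
  have hp0 : p ≠ 0 := by
    rintro rfl
    exact h Complex.I (by simp) (by simp)
  have hrr := (realRooted_of_upper p h).resolve_left hp0
  have hs : p.Splits := by
    apply Splits.of_splits_map (algebraMap ℝ ℂ) (IsAlgClosed.splits _)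
    intro a ha
    have h1 := (mem_roots'.1 ha).2
    rw [IsRoot.def, eval_map_algebraMap] at h1
    exact ⟨a.re, Complex.ext (by simp) (by simp [hrr a h1])⟩
  conv_lhs => rw [hs.eq_prod_roots]
  rw [map_mul, aeval_C, map_multiset_prod, Multiset.map_map]
  simp

lemma interlaces_of_upper (p q : Polynomial ℝ) (hp : 0 < p.leadingCoeff)
    (hq : 0 < q.leadingCoeff)
    (h : ∀ z : ℂ, 0 < z.im → 0 < (aeval z q * (starRingEnd ℂ) (aeval z p)).im) :
    Interlaces p q := by
  have hp' : ∀ z : ℂ, 0 < z.im → aeval z p ≠ 0 := by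
    intro z hz h0
    have := h z hz
    rw [h0] at this; simp at this
  have hq' : ∀ z : ℂ, 0 < z.im → aeval z q ≠ 0 := by
    intro z hz h0
    have := h z hz
    rw [h0] at this; simp at this
  have hcount : ∀ t : ℝ, t ∉ p.roots → t ∉ q.roots →
      p.roots.countP (fun β => t < β) ≤ q.roots.countP (fun β => t < β) ∧
      q.roots.countP (fun β => t < β) ≤ p.roots.countP (fun β => t < β) + 1 := by
    intro t h1 h2
    refine count_of_upper _ _ ?_ t h1 h2
    intro z hz
    have h3 := h z hz
    rw [aeval_eq_of_upper p hp', aeval_eq_of_upper q hq', map_mul, Complex.conj_ofReal,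
      mul_mul_mul_comm, ← Complex.ofReal_mul, Complex.im_ofReal_mul] at h3
    exact pos_of_mul_pos_right h3 (mul_pos hq hp).le
  right; right
  have hcard : q.roots.card ≤ p.roots.card + 1 ∧ p.roots.card ≤ q.roots.card := by
    obtain ⟨c, hc⟩ := exists_below (p.roots + q.roots)
    have e1 : p.roots.countP (fun β => c < β) = p.roots.card :=
      Multiset.countP_eq_card.2 fun a ha => hc a (by simp [-mem_roots', ha])
    have e2 : q.roots.countP (fun β => c < β) = q.roots.card :=
      Multiset.countP_eq_card.2 fun a ha => hc a (by simp [-mem_roots', ha])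
    have := hcount c (fun hh => lt_irrefl _ (hc c (Multiset.mem_add.2 (Or.inl hh))))
      (fun hh => lt_irrefl _ (hc c (Multiset.mem_add.2 (Or.inr hh))))
    omega
  refine ⟨realRooted_of_upper p hp', realRooted_of_upper q hq', hcard.1, hcard.2, ?_, ?_⟩
  · intro i h1 h2
    by_contra hneg
    obtain ⟨t, ht1, ht2, ht3, ht4⟩ := exists_generic p.roots q.roots _ _ (not_le.1 hneg)
    rw [rootsDesc_get] at ht2
    have := (rootsDesc_get q t i h2).2 (lt_of_lt_of_le ht2 (hcount t ht3 ht4).1)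
    linarith
  · intro i h1 h2
    by_contra hneg
    obtain ⟨t, ht1, ht2, ht3, ht4⟩ := exists_generic p.roots q.roots _ _ (not_le.1 hneg)
    rw [rootsDesc_get] at ht2
    have := (rootsDesc_get p t i h2).2 (by have := (hcount t ht3 ht4).2; omega)
    linarith

lemma mem_Dword (n k : ℕ) (w : Fin k → ℤ) : w ∈ Dword n k ↔ ∀ i : Fin k,
      (i.val = 0 → 1 ≤ |w i| ∧ |w i| ≤ (n : ℤ) - 1) ∧
      (i.val ≠ 0 → 1 ≤ w i ∧ w i ≤ (n : ℤ) - 1) := by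
  unfold Dword
  rw [Finset.mem_filter, and_iff_right_iff_imp]
  intro h
  rw [Fintype.mem_piFinset]
  intro i
  rw [Finset.mem_Icc]
  by_cases hi : i.val = 0
  · have := (h i).1 hi
    have h2 := abs_le.1 this.2
    omega
  · have := (h i).2 hi
    omega

lemma snoc_mem_Dword (n k : ℕ) (v : Fin (k + 1) → ℤ) (j : ℤ) :
    (Fin.snoc v j : Fin (k + 2) → ℤ) ∈ Dword n (k + 2) ↔
      v ∈ Dword n (k + 1) ∧ 1 ≤ j ∧ j ≤ (n : ℤ) - 1 := by
  rw [mem_Dword, mem_Dword, Fin.forall_fin_succ']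
  simp

lemma card_descSetD {k : ℕ} (w : Fin (k + 1) → ℤ) : (descSetD w).card =
    (Finset.univ.filter (fun i : Fin k => w i.succ < |w i.castSucc| ∨
      (w i.castSucc = w i.succ ∧ 0 < w i.succ))).card := by
  unfold descSetD
  rw [Finset.card_image_of_injective _ (fun a b h => Fin.ext (by simpa using h))]
  rfl

lemma card_descSetD_snoc {k : ℕ} (v : Fin (k + 1) → ℤ) (j : ℤ) :
    (descSetD (Fin.snoc v j : Fin (k + 2) → ℤ)).card = (descSetD v).card +
      if (j < |v (Fin.last k)| ∨ (v (Fin.last k) = j ∧ 0 < j)) then 1 else 0 := by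
  rw [card_descSetD, card_descSetD, Finset.card_filter, Finset.card_filter,
    Fin.sum_univ_castSucc]
  congr 1
  · apply Finset.sum_congr rfl
    intro i _
    rw [← Fin.castSucc_succ]
    simp only [Fin.snoc_castSucc]
  · simp

lemma hDk_eq_snoc (n k j : ℕ) (h1 : 1 ≤ j) (h2 : j ≤ n - 1) :
    hDk n (k + 2) j = ∑ v ∈ Dword n (k + 1), X ^ ((descSetD v).card +
      if ((j : ℤ) < |v (Fin.last k)| ∨ (v (Fin.last k) = j ∧ (0 : ℤ) < j)) then 1 else 0) := by
  unfold hDk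
  symm
  apply Finset.sum_bij' (fun v _ => (Fin.snoc v (j : ℤ) : Fin (k + 2) → ℤ))
    (fun w _ => Fin.init w)
  · intro v hv
    rw [Finset.mem_filter, snoc_mem_Dword]
    refine ⟨⟨hv, by omega, by omega⟩, fun _ => ?_⟩
    exact Fin.snoc_last (α := fun _ => ℤ) _ _
  · intro w hw
    rw [Finset.mem_filter, ← Fin.snoc_init_self w, snoc_mem_Dword] at hw
    exact hw.1.1
  · intro v _
    exact Fin.init_snoc (α := fun _ => ℤ) _ _
  · intro w hw
    rw [Finset.mem_filter] at hw
    have : (j : ℤ) = w (Fin.last (k + 1)) := (hw.2 (by omega)).symm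
    simp only [this]
    exact Fin.snoc_init_self w
  · intro v _
    rw [card_descSetD_snoc]

set_option maxHeartbeats 2000000 in
lemma hDk_rec (n k j : ℕ) (hk : 2 ≤ k) (h1 : 1 ≤ j) (h2 : j ≤ n - 1) :
    hDk n (k + 1) j =
        (∑ i ∈ Finset.Ico 1 j, hDk n k i) + X * ∑ i ∈ Finset.Icc j (n - 1), hDk n k i := by
  obtain ⟨k, rfl⟩ : ∃ k', k = k' + 2 := ⟨k - 2, by omega⟩
  rw [hDk_eq_snoc n (k + 1) j h1 h2]
  have hlast : ∀ v ∈ Dword n (k + 2), 1 ≤ v (Fin.last (k + 1)) ∧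
      v (Fin.last (k + 1)) ≤ (n : ℤ) - 1 := by
    intro v hv
    exact ((mem_Dword _ _ _).1 hv (Fin.last (k + 1))).2 (by simp)
  have hfib := Finset.sum_fiberwise_of_maps_to (s := Dword n (k + 2))
    (t := Finset.Icc 1 (n - 1)) (g := fun v => (v (Fin.last (k + 1))).toNat)
    (fun v hv => by have := hlast v hv; simp; omega)
    (fun v => (X : Polynomial ℝ) ^ ((descSetD v).card +
      if ((j : ℤ) < |v (Fin.last (k + 1))| ∨ (v (Fin.last (k + 1)) = j ∧ (0 : ℤ) < j))
        then 1 else 0))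
  have hterm : ∀ i ∈ Finset.Icc 1 (n - 1),
      (∑ v ∈ Dword n (k + 2) with (v (Fin.last (k + 1))).toNat = i,
        (X : Polynomial ℝ) ^ ((descSetD v).card +
      if ((j : ℤ) < |v (Fin.last (k + 1))| ∨ (v (Fin.last (k + 1)) = j ∧ (0 : ℤ) < j))
        then 1 else 0)) = hDk n (k + 2) i * (if j ≤ i then X else 1) := by
    intro i hi
    rw [Finset.mem_Icc] at hi
    unfold hDk
    rw [Finset.sum_mul]
    apply Finset.sum_congr
    · apply Finset.filter_congr
      intro v hv
      have := hlast v hv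
      constructor
      · intro h _
        change v (Fin.last (k + 1)) = i
        omega
      · intro h
        have h' : v (Fin.last (k + 1)) = i := h (by omega)
        omega
    · intro v hv
      rw [Finset.mem_filter] at hv
      have h' : v (Fin.last (k + 1)) = i := hv.2 (by omega)
      rw [h', pow_add]
      congr 1
      have hc : ((j : ℤ) < |(i : ℤ)| ∨ ((i : ℤ) = j ∧ (0 : ℤ) < j)) ↔ j ≤ i := by
        rw [abs_of_nonneg (by omega)]; omega
      simp only [hc]
      split_ifs <;> simp
  rw [← hfib, Finset.sum_congr rfl hterm]
  have hsplit : Finset.Icc 1 (n - 1) = Finset.Ico 1 j ∪ Finset.Icc j (n - 1) := by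
    ext x; simp; omega
  rw [hsplit, Finset.sum_union (by rw [Finset.disjoint_left]; intro x; simp; omega),
    Finset.mul_sum]
  congr 1
  · apply Finset.sum_congr rfl
    intro i hi
    rw [Finset.mem_Ico] at hi
    rw [if_neg (by omega), mul_one]
  · apply Finset.sum_congr rfl
    intro i hi
    rw [Finset.mem_Icc] at hi
    rw [if_pos (by omega), mul_comm]

lemma hDk_two (n j : ℕ) (h1 : 1 ≤ j) (h2 : j ≤ n - 1) :
    hDk n 2 j = C ((2 * j - 1 : ℝ)) + C ((2 * n - 1 - 2 * j : ℝ)) * X := by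
  rw [hDk_eq_snoc n 0 j h1 h2]
  have key : ∑ v ∈ Dword n 1, (X : Polynomial ℝ) ^ ((descSetD v).card +
      if ((j : ℤ) < |v (Fin.last 0)| ∨ (v (Fin.last 0) = j ∧ (0 : ℤ) < j)) then 1 else 0)
      = ∑ a ∈ Finset.Icc (-((n : ℤ) - 1)) (-1) ∪ Finset.Icc 1 ((n : ℤ) - 1),
        X ^ (if ((j : ℤ) < |a| ∨ (a = j ∧ (0 : ℤ) < j)) then 1 else 0) := by
    refine Finset.sum_bij' (fun v _ => v 0) (fun a _ => fun _ => a) ?_ ?_ ?_ ?_ ?_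
    · intro v hv
      have := ((mem_Dword _ _ _).1 hv 0).1 rfl
      rw [Finset.mem_union, Finset.mem_Icc, Finset.mem_Icc]
      rcases abs_cases (v 0) with h | h <;> omega
    · intro a ha
      rw [Finset.mem_union, Finset.mem_Icc, Finset.mem_Icc] at ha
      rw [mem_Dword]
      intro i
      have : i.val = 0 := by omega
      refine ⟨fun _ => ?_, fun h => absurd this h⟩
      rcases abs_cases a with h | h <;> omega
    · intro v _
      funext i
      rw [Subsingleton.elim i 0]
    · intro a _; rfl
    · intro v _
      have : (descSetD v).card = 0 := by rw [card_descSetD]; simp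
      rw [this, zero_add]
      rfl
  rw [key]
  have hs : Finset.Icc (-((n : ℤ) - 1)) (-1) ∪ Finset.Icc 1 ((n : ℤ) - 1) =
      (Finset.Icc (-(j : ℤ)) (-1) ∪ Finset.Icc 1 ((j : ℤ) - 1)) ∪
      (Finset.Icc (-((n : ℤ) - 1)) (-(j : ℤ) - 1) ∪ Finset.Icc (j : ℤ) ((n : ℤ) - 1)) := by
    ext x; simp only [Finset.mem_union, Finset.mem_Icc]; omega
  rw [hs, Finset.sum_union]
  · congr 1
    · rw [Finset.sum_congr rfl (g := fun _ => (1 : Polynomial ℝ))]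
      · rw [Finset.sum_const, Finset.card_union_of_disjoint, Int.card_Icc, Int.card_Icc]
        · have : (-1 + 1 - -(j : ℤ)).toNat + ((j : ℤ) - 1 + 1 - 1).toNat = 2 * j - 1 := by omega
          rw [this, nsmul_one, ← map_natCast (C : ℝ →+* Polynomial ℝ), Nat.cast_sub (by omega)]
          push_cast; rfl
        · rw [Finset.disjoint_left]; intro x; simp only [Finset.mem_Icc]; omega
      · intro a ha
        rw [Finset.mem_union, Finset.mem_Icc, Finset.mem_Icc] at ha
        rw [if_neg, pow_zero]
        rcases abs_cases a with h | h <;> omega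
    · rw [Finset.sum_congr rfl (g := fun _ => (X : Polynomial ℝ))]
      · rw [Finset.sum_const, Finset.card_union_of_disjoint, Int.card_Icc, Int.card_Icc]
        · have : (-(j : ℤ) - 1 + 1 - -((n : ℤ) - 1)).toNat + ((n : ℤ) - 1 + 1 - j).toNat
            = 2 * n - 1 - 2 * j := by omega
          rw [this, nsmul_eq_mul, ← map_natCast (C : ℝ →+* Polynomial ℝ),
            Nat.cast_sub (by omega), Nat.cast_sub (by omega)]
          push_cast; rfl
        · rw [Finset.disjoint_left]; intro x; simp only [Finset.mem_Icc]; omega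
      · intro a ha
        rw [Finset.mem_union, Finset.mem_Icc, Finset.mem_Icc] at ha
        rw [if_pos, pow_one]
        rcases abs_cases a with h | h <;> omega
  · rw [Finset.disjoint_left]; intro x; simp only [Finset.mem_union, Finset.mem_Icc]; omega

lemma good_hDk (n : ℕ) (z : ℂ) (hz : 0 < z.im) (k : ℕ) (hk : 2 ≤ k) :
    GoodSeq (n - 1) (fun j => aeval z (hDk n k j)) z := by
  induction k, hk using Nat.le_induction with
  | base =>
    have hb : ∀ j, 1 ≤ j → j ≤ n - 1 →
        ∃ a b : ℝ, aeval z (hDk n 2 j) = (a : ℂ) + (b : ℂ) * z ∧ a = 2 * j - 1 ∧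
          b = 2 * n - 1 - 2 * j ∧ 0 < a ∧ 0 < b := by
      intro j h1 h2
      refine ⟨_, _, ?_, rfl, rfl, ?_, ?_⟩
      · rw [hDk_two n j h1 h2]; simp
      · have : (1 : ℝ) ≤ j := by exact_mod_cast h1
        linarith
      · have : (j : ℝ) + 1 ≤ n := by exact_mod_cast (by omega : j + 1 ≤ n)
        linarith
    have hpair : ∀ i j, 1 ≤ i → i < j → j ≤ n - 1 → ∃ a b c d : ℝ,
        aeval z (hDk n 2 i) = (a : ℂ) + (b : ℂ) * z ∧
        aeval z (hDk n 2 j) = (c : ℂ) + (d : ℂ) * z ∧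
        0 < a ∧ 0 < b ∧ 0 < c ∧ 0 < d ∧ a * d < b * c := by
      intro i j h1 hij h2
      obtain ⟨a, b, e1, ha, hb', ha0, hb0⟩ := hb i h1 (by omega)
      obtain ⟨c, d, e2, hc, hd, hc0, hd0⟩ := hb j (by omega) h2
      refine ⟨a, b, c, d, e1, e2, ha0, hb0, hc0, hd0, ?_⟩
      have hij' : (i : ℝ) < j := by exact_mod_cast hij
      have : a < c := by linarith
      have : d < b := by linarith
      nlinarith
    refine ⟨?_, ?_, ?_⟩
    · intro j h1 h2 h0
      obtain ⟨a, b, e1, -, -, ha0, hb0⟩ := hb j h1 h2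
      simp only [e1] at h0
      have := congrArg Complex.im h0
      simp at this
      rcases this with h | h <;> linarith
    · intro i j h1 hij h2
      obtain ⟨a, b, c, d, e1, e2, ha, hb, hc, hd, h⟩ := hpair i j h1 hij h2
      simp only [e1, e2]
      have : (((a : ℂ) + b * z) * (starRingEnd ℂ) ((c : ℂ) + d * z)).im =
          z.im * (b * c - a * d) := by simp; ring
      rw [this]
      exact mul_pos hz (by linarith)
    · intro i j h1 hij h2
      obtain ⟨a, b, c, d, e1, e2, ha, hb, hc, hd, h⟩ := hpair i j h1 hij h2
      simp only [e1, e2]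
      have : (z * ((c : ℂ) + d * z) * (starRingEnd ℂ) ((a : ℂ) + b * z)).im =
          z.im * (a * c + 2 * z.re * (a * d) + b * d * z.re ^ 2 + b * d * z.im ^ 2) := by
        simp; ring
      rw [this]
      apply mul_nonneg hz.le
      have hbd := mul_pos hb hd
      have h3 : 0 ≤ a * c + 2 * z.re * (a * d) + b * d * z.re ^ 2 := by
        have : 0 ≤ b * (a * c + 2 * z.re * (a * d) + b * d * z.re ^ 2) := by
          have e : b * (a * c + 2 * z.re * (a * d) + b * d * z.re ^ 2) =
            d * (b * z.re + a) ^ 2 + a * (b * c - a * d) := by ring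
          rw [e]
          have := mul_pos ha (sub_pos.2 h)
          positivity
        exact nonneg_of_mul_nonneg_right this hb
      positivity
  | succ k hk ih =>
    refine GoodSeq.step hz ih ?_
    intro j h1 h2
    simp only [hDk_rec n k j hk h1 h2, map_add, map_mul, map_sum, aeval_X]

lemma hDk_coeff_nonneg (n k j i : ℕ) : 0 ≤ (hDk n k j).coeff i := by
  unfold hDk
  rw [finsetSum_coeff]
  refine Finset.sum_nonneg fun w _ => ?_
  rw [coeff_X_pow]
  split_ifs <;> norm_num

lemma hDk_leadingCoeff_pos (n k j : ℕ) (hk : 2 ≤ k) (h1 : 1 ≤ j) (h2 : j ≤ n - 1) :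
    0 < (hDk n k j).leadingCoeff := by
  refine lt_of_le_of_ne (hDk_coeff_nonneg n k j _) ?_
  intro h
  have h0 := leadingCoeff_eq_zero.1 h.symm
  apply (good_hDk n Complex.I (by simp) k hk).ne j h1 h2
  simp [h0]

/-- For `n, k ≥ 2`: (i) `h_{n,k+1,j}(x) = Σ_{i=1}^{j-1} h_{n,k,i}(x)
+ x·Σ_{i=j}^{n-1} h_{n,k,i}(x)` for every `j ∈ [n-1]`; and (ii) the sequence
`(h_{n,k,n-1}, …, h_{n,k,2}, h_{n,k,1})` is an interlacing sequence of real-rooted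
polynomials. -/
theorem stmt17 (n k : ℕ) (hn : 2 ≤ n) (hk : 2 ≤ k) :
    (∀ j : ℕ, 1 ≤ j → j ≤ n - 1 →
      hDk n (k + 1) j =
        (∑ i ∈ Finset.Ico 1 j, hDk n k i) + X * ∑ i ∈ Finset.Icc j (n - 1), hDk n k i) ∧
    (∀ j : ℕ, 1 ≤ j → j ≤ n - 1 → RealRooted (hDk n k j)) ∧
    (∀ i j : ℕ, 1 ≤ i → i < j → j ≤ n - 1 → Interlaces (hDk n k j) (hDk n k i)) := by
  refine ⟨fun j h1 h2 => hDk_rec n k j hk h1 h2, fun j h1 h2 => ?_, fun i j h1 hij h2 => ?_⟩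
  · exact realRooted_of_upper _ fun z hz => (good_hDk n z hz k hk).ne j h1 h2
  · exact interlaces_of_upper _ _ (hDk_leadingCoeff_pos n k j hk (by omega) h2)
      (hDk_leadingCoeff_pos n k i hk h1 (by omega))
      fun z hz => (good_hDk n z hz k hk).lt i j h1 hij h2
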